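/- For the ReLU function σ(t) = max(t,0) and its degree-q Hermite truncation σ̃(t) = Σ_{j=0}^q c_j h_j(t), the truncation error satisfies E_{t∼N(0,1)}[(σ(t)-σ̃(t))²] ≤ 1/(√(2π)(q+1)). -/

import Mathlib

open MeasureTheory ProbabilityTheory Real

/-- Probabilist's Hermite polynomial via the Rodrigues formula. -/
noncomputable def hermiteR (ℓ : ℕ) (t : ℝ) : ℝ :=
  (-1) ^ ℓ * Real.exp (t ^ 2 / 2) * iteratedDeriv ℓ (fun s => Real.exp (-s ^ 2 / 2)) t


noncomputable def aC : ℕ → ℝ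
  | 0 => 1
  | (k+1) => aC k * (2*k+1) / (2*k+2)

lemma aC_nonneg (k : ℕ) : 0 ≤ aC k := by
  induction k with
  | zero => simp [aC]
  | succ k ih => rw [aC]; positivity

lemma aC_le (k : ℕ) : aC (k+1) ≤ 1/2 := by
  induction k with
  | zero => norm_num [aC]
  | succ k ih =>
    rw [aC, div_le_iff₀ (by positivity)]
    have := aC_nonneg (k+1)
    push_cast
    nlinarith

lemma sin_bound {x : ℝ} (h0 : 0 ≤ x) (h1 : x ≤ π/2) : x - sin x ≤ 2 * sin x ^ 3 := by
  have hpi := Real.pi_lt_d2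
  rcases h0.eq_or_lt with h | h
  · subst h; simp
  rcases le_or_gt x 1 with hx | hx
  · have a := Real.sin_gt_sub_cube h
    have b : 3/4 * x ≤ sin x := by nlinarith [mul_pos h h, mul_nonneg h.le (sub_nonneg.2 hx)]
    have c : (3/4*x)^3 ≤ sin x ^ 3 := by gcongr
    have d : 0 < x^3 := by positivity
    nlinarith
  · have a := Real.sin_gt_sub_cube (x := 1) (by norm_num)
    have b : sin 1 ≤ sin x := Real.sin_le_sin_of_le_of_le_pi_div_two (by linarith) h1 hx.le
    have c : (3/4:ℝ) ≤ sin x := by norm_num at a; linarith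
    have d : (3/4:ℝ)^3 ≤ sin x ^ 3 := by gcongr
    norm_num at d
    linarith

noncomputable def kF (m : ℕ) (x : ℝ) : ℝ := 1 - cos x * ∑ k ∈ Finset.range m, aC k * sin x ^ (2*k)
noncomputable def hF (m : ℕ) (x : ℝ) : ℝ := x - ∑ k ∈ Finset.range m, aC k * sin x ^ (2*k+1) / (2*k+1)
noncomputable def gF (m : ℕ) (x : ℝ) : ℝ :=
  x * sin x + cos x - 1 - ∑ k ∈ Finset.range m, aC k * sin x ^ (2*k+2) / ((2*k+1)*(2*k+2))

lemma kF_deriv (m : ℕ) (x : ℝ) :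
    HasDerivAt (kF (m+1)) (2*(m+1) * aC (m+1) * sin x ^ (2*m+1)) x := by
  induction m with
  | zero =>
    have : kF (0+1) = fun x => 1 - cos x := by ext y; simp [kF, aC]
    rw [this]
    refine HasDerivAt.congr_deriv ((Real.hasDerivAt_cos x).const_sub 1) ?_
    simp [aC]
  | succ m ih =>
    have : kF (m+1+1) = fun x => kF (m+1) x - cos x * (aC (m+1) * sin x ^ (2*m+2)) := by
      ext y; simp only [kF]; rw [Finset.sum_range_succ _ (m+1)]; ring
    rw [this]
    refine HasDerivAt.congr_deriv (ih.sub ((Real.hasDerivAt_cos x).mul (((Real.hasDerivAt_sin x).pow (2*m+2)).const_mul (aC (m+1))))) ?_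
    rw [aC.eq_2 (m+1)]
    have hc : cos x * cos x = 1 - sin x ^ 2 := by rw [← Real.cos_sq']; ring
    have : (2*((m:ℝ)+1)+2) ≠ 0 := by positivity
    simp only [show 2*m+2-1 = 2*m+1 by omega]
    push_cast
    field_simp
    linear_combination (-(2*(m:ℝ)+2)*aC (m+1) * sin x ^ (2*m+1)) * hc

lemma hF_deriv (m : ℕ) (x : ℝ) : HasDerivAt (hF m) (kF m x) x := by
  unfold hF kF
  refine (hasDerivAt_id' x).sub ?_
  rw [Finset.mul_sum]
  refine HasDerivAt.fun_sum fun k _ => ?_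
  refine HasDerivAt.congr_deriv ((((Real.hasDerivAt_sin x).pow (2*k+1)).const_mul (aC k)).div_const (2*(k:ℝ)+1)) ?_
  have : (2*(k:ℝ)+1) ≠ 0 := by positivity
  push_cast
  field_simp

lemma gF_deriv (m : ℕ) (x : ℝ) : HasDerivAt (gF m) (cos x * hF m x) x := by
  unfold hF gF
  have h1 : HasDerivAt (fun x => x * sin x + cos x - 1) (cos x * x) x := by
    refine HasDerivAt.congr_deriv ((((hasDerivAt_id' x).mul (Real.hasDerivAt_sin x)).add (Real.hasDerivAt_cos x)).sub_const 1) ?_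
    ring
  rw [mul_sub]
  refine h1.sub ?_
  rw [Finset.mul_sum]
  refine HasDerivAt.fun_sum fun k _ => ?_
  refine HasDerivAt.congr_deriv ((((Real.hasDerivAt_sin x).pow (2*k+2)).const_mul (aC k)).div_const ((2*(k:ℝ)+1)*(2*k+2))) ?_
  have : (2*(k:ℝ)+1) ≠ 0 := by positivity
  have : (2*(k:ℝ)+2) ≠ 0 := by positivity
  push_cast
  field_simp

lemma series_bound (m : ℕ) :
    π/2 - (1 + ∑ k ∈ Finset.range (m+1), aC k / ((2*k+1)*(2*k+2))) ≤ 2 / (2*m+4) := by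
  let V : ℝ → ℝ := fun x => 2*(2*(m+1)*aC (m+1)) * (sin x^(2*m+2)/(2*m+2) - sin x^(2*m+4)/(2*m+4))
    - ((π/2 - x - cos x) * kF (m+1) x + (1 - sin x) * hF (m+1) x + gF (m+1) x)
  have hV : ∀ x, HasDerivAt V (2*(m+1)*aC (m+1) * sin x^(2*m+1) * (2 * cos x^3 - (π/2 - x - cos x))) x := by
    intro x
    have h1 := ((((Real.hasDerivAt_sin x).pow (2*m+2)).div_const (2*(m:ℝ)+2)).sub
      (((Real.hasDerivAt_sin x).pow (2*m+4)).div_const (2*(m:ℝ)+4))).const_mul (2*(2*(m+1)*aC (m+1)))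
    have h2 := (((((hasDerivAt_id' x).const_sub (π/2)).sub (Real.hasDerivAt_cos x)).mul (kF_deriv m x)).add
      (((Real.hasDerivAt_sin x).const_sub 1).mul (hF_deriv (m+1) x))).add (gF_deriv (m+1) x)
    refine (h1.sub h2).congr_deriv ?_
    simp only [show 2*m+2-1 = 2*m+1 by omega, show 2*m+4-1 = 2*m+3 by omega, Pi.sub_apply]
    have hc : cos x ^3 = cos x * (1 - sin x ^ 2) := by rw [← Real.cos_sq']; ring
    rw [hc]
    push_cast
    have : (2*(m:ℝ)+2) ≠ 0 := by positivity
    have : (2*(m:ℝ)+4) ≠ 0 := by positivity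
    field_simp
    ring
  have mono : MonotoneOn V (Set.Icc 0 (π/2)) := by
    refine monotoneOn_of_deriv_nonneg (convex_Icc _ _) (fun x _ => (hV x).continuousAt.continuousWithinAt)
      (fun x _ => (hV x).differentiableAt.differentiableWithinAt) ?_
    intro x hx
    rw [interior_Icc] at hx
    rw [(hV x).deriv]
    have h1 := sin_bound (x := π/2 - x) (by linarith [hx.2]) (by linarith [hx.1])
    rw [Real.sin_pi_div_two_sub] at h1
    have h2 : 0 ≤ sin x := Real.sin_nonneg_of_nonneg_of_le_pi hx.1.le (by linarith [hx.2, Real.pi_pos])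
    have h3 := aC_nonneg (m+1)
    have h4 : 0 ≤ 2 * cos x^3 - (π/2 - x - cos x) := by linarith
    positivity
  have hp := Real.pi_pos
  have := mono (a := 0) (b := π/2) ⟨le_rfl, by positivity⟩ ⟨by positivity, le_rfl⟩ (by positivity)
  have e0 : V 0 = 0 := by
    simp [V, kF, hF, gF, Finset.sum_range_succ', aC]
  have e1 : V (π/2) = 2*(2*(m+1)*aC (m+1)) * (1/(2*m+2) - 1/(2*m+4)) -
      (π/2 - (1 + ∑ k ∈ Finset.range (m+1), aC k / ((2*k+1)*(2*k+2)))) := by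
    simp [V, kF, hF, gF]; ring
  rw [e0, e1] at this
  have e2 : 2*(2*(m+1)*aC (m+1)) * (1/(2*(m:ℝ)+2) - 1/(2*m+4)) = 4 * aC (m+1) / (2*m+4) := by
    have : (2*(m:ℝ)+2) ≠ 0 := by positivity
    have : (2*(m:ℝ)+4) ≠ 0 := by positivity
    field_simp
    ring
  have e3 : 4 * aC (m+1) / (2*(m:ℝ)+4) ≤ 2 / (2*m+4) := by
    gcongr; linarith [aC_le m]
  linarith
open Polynomial in
noncomputable def HP (n : ℕ) : ℝ[X] := (hermite n).map (Int.castRingHom ℝ)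

noncomputable def wG (x : ℝ) : ℝ := Real.exp (-(x^2/2))

open Polynomial in
lemma HP_succ (n : ℕ) : HP (n+1) = X * HP n - derivative (HP n) := by
  simp [HP, hermite_succ, derivative_map]

lemma HP_zero : HP 0 = 1 := by simp [HP]
lemma HP_one : HP 1 = Polynomial.X := by simp [HP]

lemma hermiteR_eq (n : ℕ) (t : ℝ) : hermiteR n t = (HP n).eval t := by
  have h := Polynomial.hermite_eq_deriv_gaussian' n t
  have e : (fun y : ℝ => Real.exp (-(y ^ 2 / 2))) = fun s => Real.exp (-s ^ 2 / 2) := by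
    ext y; congr 1; ring
  rw [e] at h
  rw [hermiteR, iteratedDeriv_eq_iterate, HP, Polynomial.eval_map]
  rw [Polynomial.aeval_def] at h
  have h2 : (algebraMap ℤ ℝ) = Int.castRingHom ℝ := rfl
  rw [h2] at h
  rw [h]; ring

lemma wG_eq (x : ℝ) : wG x = Real.exp (-(1/2) * x^2) := by
  unfold wG; congr 1; ring

lemma integrable_poly (P : Polynomial ℝ) : Integrable (fun x => P.eval x * wG x) := by
  induction P using Polynomial.induction_on' with
  | add p q hp hq =>
    refine (hp.add hq).congr (Filter.Eventually.of_forall fun x => ?_)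
    simp [add_mul]
  | monomial n a =>
    have := (integrable_rpow_mul_exp_neg_mul_sq (b := 1/2) (by norm_num) (s := (n:ℝ))
      (by have : (0:ℝ) ≤ n := Nat.cast_nonneg n
          linarith)).const_mul a
    refine this.congr (Filter.Eventually.of_forall fun x => ?_)
    simp [wG_eq, mul_assoc]

open Polynomial in
lemma poly_deriv (P : ℝ[X]) (x : ℝ) :
    HasDerivAt (fun x => P.eval x * wG x) ((derivative P - X * P).eval x * wG x) x := by
  have h1 : HasDerivAt wG (wG x * (-x)) x := by
    unfold wG
    have : HasDerivAt (fun x : ℝ => -(x^2/2)) (-x) x := by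
      refine (((hasDerivAt_id' x).pow 2).div_const 2).neg.congr_deriv ?_
      simp
    exact this.exp
  refine ((P.hasDerivAt x).mul h1).congr_deriv ?_
  simp; ring

open Polynomial in
lemma integral_full (P : ℝ[X]) : ∫ x, (X * P - derivative P).eval x * wG x = 0 := by
  have h := integral_eq_zero_of_hasDerivAt_of_integrable (poly_deriv P) (integrable_poly _) (integrable_poly _)
  rw [← neg_eq_zero, ← integral_neg, ← h]
  congr 1; ext x; simp; ring

open Polynomial in
lemma integral_half (P : ℝ[X]) :
    ∫ x in Set.Ioi 0, (X * P - derivative P).eval x * wG x = P.eval 0 := by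
  have ht := tendsto_zero_of_hasDerivAt_of_integrableOn_Ioi (a := 0) (fun x _ => poly_deriv P x)
    (integrable_poly _).integrableOn (integrable_poly _).integrableOn
  have h := integral_Ioi_of_hasDerivAt_of_tendsto (a := 0) (poly_deriv P 0).continuousAt.continuousWithinAt
    (fun x _ => poly_deriv P x) (integrable_poly _).integrableOn ht
  have h0 : wG 0 = 1 := by simp [wG]
  rw [h0] at h
  rw [← neg_inj, ← integral_neg]
  rw [show -(P.eval 0) = 0 - P.eval 0 * 1 by ring, ← h]
  congr 1; ext x; simp; ring

open Polynomial in
lemma ibp (p : ℝ[X]) (j : ℕ) :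
    ∫ x, (p * HP (j+1)).eval x * wG x = ∫ x, (derivative p * HP j).eval x * wG x := by
  have h := integral_full (p * HP j)
  rw [← sub_eq_zero, ← integral_sub (integrable_poly _) (integrable_poly _), ← h]
  congr 1; ext x
  rw [← sub_mul, ← eval_sub, HP_succ, derivative_mul]
  congr 2; ring

lemma two_pi_int : ∫ x, wG x = √(2*π) := by
  simp_rw [wG_eq]
  rw [integral_gaussian]; congr 1; ring

open Polynomial in
lemma ibp_iter (j : ℕ) (p : ℝ[X]) :
    ∫ x, (p * HP j).eval x * wG x = ∫ x, (derivative^[j] p).eval x * wG x := by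
  induction j generalizing p with
  | zero => simp [HP_zero]
  | succ j ih => rw [ibp, ih, Function.iterate_succ_apply]

lemma HP_natDegree (j : ℕ) : (HP j).natDegree = j := by
  rw [HP, Polynomial.natDegree_map_eq_of_injective (RingHom.injective_int _), Polynomial.natDegree_hermite]

open Polynomial in
lemma orth_lt {i j : ℕ} (h : i < j) : ∫ x, (HP i * HP j).eval x * wG x = 0 := by
  rw [ibp_iter, iterate_derivative_eq_zero (by rwa [HP_natDegree])]; simp

open Polynomial in
lemma orth_eq (j : ℕ) : ∫ x, (HP j * HP j).eval x * wG x = √(2*π) * j.factorial := by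
  have : derivative^[j] (HP j) = C (j.factorial : ℝ) := by
    have hd : (derivative^[j] (HP j)).natDegree = 0 := by
      have := natDegree_iterate_derivative (HP j) j
      rw [HP_natDegree] at this; omega
    rw [eq_C_of_natDegree_eq_zero hd, coeff_iterate_derivative]
    simp [HP, Nat.descFactorial_self]
  rw [ibp_iter, this]
  simp only [eval_C]
  rw [integral_const_mul, two_pi_int, mul_comm]

lemma orth (i j : ℕ) : ∫ x, (HP i * HP j).eval x * wG x = if i = j then √(2*π) * j.factorial else 0 := by
  split_ifs with h
  · subst h; exact orth_eq i
  · rcases lt_or_gt_of_ne h with h | h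
    · exact orth_lt h
    · rw [mul_comm]; exact orth_lt h

lemma relu_ind (P : Polynomial ℝ) (x : ℝ) : max x 0 * P.eval x * wG x =
    Set.indicator (Set.Ioi 0) (fun x => (Polynomial.X * P).eval x * wG x) x := by
  by_cases h : 0 < x
  · simp [h, h.le]
  · simp [h, max_eq_right (not_lt.1 h)]

lemma relu_integrable (P : Polynomial ℝ) : Integrable (fun x => max x 0 * P.eval x * wG x) := by
  simp_rw [relu_ind]
  exact (integrable_poly _).indicator measurableSet_Ioi

lemma relu_integral (P : Polynomial ℝ) : ∫ x, max x 0 * P.eval x * wG x =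
    ∫ x in Set.Ioi 0, (Polynomial.X * P).eval x * wG x := by
  simp_rw [relu_ind]
  exact integral_indicator measurableSet_Ioi

lemma relu_sq (x : ℝ) : max x 0 ^ 2 * wG x = max x 0 * (Polynomial.X).eval x * wG x := by
  rcases le_total x 0 with h | h
  · simp [h]
  · simp [h, pow_two]

open Polynomial in
lemma M_succ (j : ℕ) : ∫ x, max x 0 * (HP (j+2)).eval x * wG x = (HP j).eval 0 := by
  rw [relu_integral]
  have h := integral_half (X * HP (j+1) + HP j)
  have e : X * (X * HP (j+1) + HP j) - derivative (X * HP (j+1) + HP j) = X * HP (j+2) := by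
    rw [HP_succ (j+1), derivative_add, derivative_mul, derivative_X]
    have := HP_succ j
    linear_combination -this
  rw [e] at h
  rw [h]; simp

open Polynomial in
lemma M_zero : ∫ x, max x 0 * (HP 0).eval x * wG x = 1 := by
  rw [relu_integral, HP_zero]
  have h := integral_half 1
  simpa using h

open Polynomial in
lemma M_one : ∫ x, max x 0 * (X : ℝ[X]).eval x * wG x = √(2*π)/2 := by
  rw [relu_integral]
  have h := integral_half X
  have h2 : ∫ x in Set.Ioi 0, wG x = √(2*π)/2 := by
    simp_rw [wG_eq]
    rw [integral_gaussian_Ioi]; congr 2; ring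
  have h3 : ∫ x in Set.Ioi 0, (X * X - derivative (X:ℝ[X])).eval x * wG x =
    (∫ x in Set.Ioi 0, (X * X : ℝ[X]).eval x * wG x) - ∫ x in Set.Ioi 0, wG x := by
    rw [← integral_sub (integrable_poly _).integrableOn]
    · congr 1; ext x; simp; ring
    · have := (integrable_poly 1).integrableOn (s := Set.Ioi 0)
      simp only [eval_one, one_mul] at this
      exact this
  rw [h3, h2] at h
  simp only [eval_X] at h
  linarith

lemma gauss_int (f : ℝ → ℝ) : ∫ t, f t ∂(gaussianReal 0 1) = (√(2*π))⁻¹ * ∫ t, f t * wG t := by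
  rw [integral_gaussianReal_eq_integral_smul (by norm_num), ← integral_const_mul]
  congr 1; ext x
  simp only [gaussianPDFReal_def, wG, smul_eq_mul]
  simp only [NNReal.coe_one, mul_one, sub_zero]
  rw [show -x^2/2 = -(x^2/2) by ring]; ring

lemma error_eq (q : ℕ) (c : ℕ → ℝ)
    (hc : ∀ j, ∫ x, max x 0 * (HP j).eval x * wG x = √(2*π) * j.factorial * c j) :
    ∫ x, (max x 0 - ∑ j ∈ Finset.range q, c j * (HP j).eval x)^2 * wG x =
     √(2*π) * (1/2 - ∑ j ∈ Finset.range q, c j^2 * j.factorial) := by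
  have e : ∀ x, (max x 0 - ∑ j ∈ Finset.range q, c j * (HP j).eval x)^2 * wG x =
      max x 0 * (Polynomial.X).eval x * wG x
      - 2 * ∑ j ∈ Finset.range q, c j * (max x 0 * (HP j).eval x * wG x)
      + ∑ i ∈ Finset.range q, ∑ j ∈ Finset.range q, (c i * c j) * ((HP i * HP j).eval x * wG x) := by
    intro x
    rw [← relu_sq]
    have e1 : ∑ j ∈ Finset.range q, c j * (max x 0 * (HP j).eval x * wG x) =
      max x 0 * (∑ j ∈ Finset.range q, c j * (HP j).eval x) * wG x := by
      rw [Finset.mul_sum, Finset.sum_mul]; exact Finset.sum_congr rfl fun _ _ => by ring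
    have e2 : ∑ i ∈ Finset.range q, ∑ j ∈ Finset.range q, (c i * c j) * ((HP i * HP j).eval x * wG x) =
      (∑ j ∈ Finset.range q, c j * (HP j).eval x) * (∑ j ∈ Finset.range q, c j * (HP j).eval x) * wG x := by
      rw [Finset.sum_mul_sum, Finset.sum_mul]
      refine Finset.sum_congr rfl fun _ _ => ?_
      rw [Finset.sum_mul]
      exact Finset.sum_congr rfl fun _ _ => by rw [Polynomial.eval_mul]; ring
    rw [e1, e2]; ring
  have i1 : Integrable fun x => ∑ j ∈ Finset.range q, c j * (max x 0 * (HP j).eval x * wG x) :=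
    integrable_finsetSum _ fun j _ => (relu_integrable _).const_mul _
  have i2 : ∀ i, Integrable fun x => ∑ j ∈ Finset.range q, (c i * c j) * ((HP i * HP j).eval x * wG x) :=
    fun i => integrable_finsetSum _ fun j _ => (integrable_poly _).const_mul _
  simp_rw [e]
  have i3 : Integrable fun x => max x 0 * (Polynomial.X).eval x * wG x
      - 2 * ∑ j ∈ Finset.range q, c j * (max x 0 * (HP j).eval x * wG x) :=
    (relu_integrable _).sub (i1.const_mul 2)
  rw [integral_add i3 (integrable_finsetSum _ fun i _ => i2 i),
    integral_sub (relu_integrable _) (i1.const_mul 2), integral_const_mul, M_one,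
    integral_finsetSum _ fun j _ => (relu_integrable _).const_mul _,
    integral_finsetSum _ fun i _ => i2 i]
  have e3 : ∑ i ∈ Finset.range q, ∫ x, ∑ j ∈ Finset.range q, (c i * c j) * ((HP i * HP j).eval x * wG x)
     = √(2*π) * ∑ j ∈ Finset.range q, c j^2 * j.factorial := by
    rw [Finset.mul_sum]
    refine Finset.sum_congr rfl fun i hi => ?_
    rw [integral_finsetSum _ fun j _ => (integrable_poly _).const_mul _]
    simp_rw [integral_const_mul, orth]
    simp only [mul_ite, mul_zero, Finset.sum_ite_eq, hi, if_true]
    ring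
  have e4 : ∑ j ∈ Finset.range q, ∫ x, c j * (max x 0 * (HP j).eval x * wG x)
     = √(2*π) * ∑ j ∈ Finset.range q, c j^2 * j.factorial := by
    rw [Finset.mul_sum]
    refine Finset.sum_congr rfl fun i hi => ?_
    rw [integral_const_mul, hc]; ring
  rw [e3, e4]; ring

lemma HP_zero_sq (k : ℕ) : (HP (2*k)).eval 0 ^ 2 = aC k * (2*k).factorial := by
  have h : (HP (2*k)).eval 0 = (-1)^k * (Nat.doubleFactorial (2*k-1) : ℝ) := by
    have := Polynomial.coeff_hermite_explicit k 0
    rw [add_zero] at this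
    rw [HP, ← Polynomial.coeff_zero_eq_eval_zero, Polynomial.coeff_map, this]
    simp
  have h2 : (Nat.doubleFactorial (2*k-1) : ℝ)^2 = aC k * (2*k).factorial := by
    clear h
    induction k with
    | zero => simp [aC]
    | succ k ih =>
      have e : Nat.doubleFactorial (2*(k+1)-1) = (2*k+1) * Nat.doubleFactorial (2*k-1) := by
        rcases k with _ | k
        · simp
        · rw [show 2*(k+1+1)-1 = (2*k+1)+2 by omega, Nat.doubleFactorial_add_two]
          congr 1
      rw [e, aC, show 2*(k+1) = 2*k+1+1 by ring, Nat.factorial_succ, Nat.factorial_succ]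
      push_cast
      rw [mul_pow, ih]
      have : (2*(k:ℝ)+2) ≠ 0 := by positivity
      field_simp
      ring
  rw [h, mul_pow, h2, ← pow_mul, mul_comm k 2, pow_mul]; simp

lemma coef_bound (c : ℕ → ℝ)
    (hc : ∀ j, ∫ x, max x 0 * (HP j).eval x * wG x = √(2*π) * j.factorial * c j) :
    c 0 = (√(2*π))⁻¹ ∧ c 1 = 1/2 ∧
    ∀ k : ℕ, c (2*k+2)^2 * (2*k+2).factorial = aC k / ((2*k+1)*(2*k+2)) / (2*π) := by
  have hs : 0 < √(2*π) := by positivity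
  have hsq : √(2*π)^2 = 2*π := Real.sq_sqrt (by positivity)
  refine ⟨?_, ?_, fun k => ?_⟩
  · have h := hc 0
    rw [M_zero] at h
    simp only [Nat.factorial_zero, Nat.cast_one, mul_one] at h
    exact eq_inv_of_mul_eq_one_right h.symm
  · have h := hc 1
    rw [HP_one, M_one] at h
    simp at h
    field_simp at h
    linarith
  · have h := hc (2*k+2)
    rw [M_succ] at h
    have h2 := HP_zero_sq k
    rw [h, mul_pow, mul_pow, hsq, Nat.factorial_succ, Nat.factorial_succ] at h2
    rw [Nat.factorial_succ, Nat.factorial_succ]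
    push_cast at h2 ⊢
    have : ((2*k).factorial : ℝ) ≠ 0 := by positivity
    have : (2*(k:ℝ)+1) ≠ 0 := by positivity
    have : (2*(k:ℝ)+2) ≠ 0 := by positivity
    have hp := Real.pi_pos
    rw [div_div, eq_div_iff (by positivity)]
    apply mul_right_cancel₀ ‹((2*k).factorial : ℝ) ≠ 0›
    rw [← h2]
    ring

lemma partial_sum (c : ℕ → ℝ) 
    (hc : ∀ j, ∫ x, max x 0 * (HP j).eval x * wG x = √(2*π) * j.factorial * c j) (m : ℕ) :
    1/4 + (1 + ∑ k ∈ Finset.range (m+1), aC k / ((2*k+1)*(2*k+2))) / (2*π) ≤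
      ∑ j ∈ Finset.range (2*m+3), c j^2 * j.factorial := by
  obtain ⟨h0, h1, h2⟩ := coef_bound c hc
  have hsq : √(2*π)^2 = 2*π := Real.sq_sqrt (by positivity)
  induction m with
  | zero =>
    have := h2 0
    simp only [mul_zero, zero_add, Finset.sum_range_succ, Finset.sum_range_zero] at this ⊢
    rw [this, h0, h1, inv_pow, hsq]
    apply le_of_eq
    simp
    ring
  | succ m ih =>
    rw [show 2*(m+1)+3 = 2*m+3+1+1 by ring, Finset.sum_range_succ _ (2*m+3+1),
      Finset.sum_range_succ _ (2*m+3), Finset.sum_range_succ _ (m+1)]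
    have := h2 (m+1)
    rw [show 2*(m+1)+2 = 2*m+3+1 by ring] at this
    rw [this, ← add_assoc, add_div _ _ (2*π)]
    have : 0 ≤ c (2*m+3)^2 * (2*m+3).factorial := by positivity
    linarith

lemma sqrt_bounds : 2.5 ≤ √(2*π) ∧ √(2*π) ≤ 2.51 := by
  have h1 := Real.pi_gt_d2
  have h2 := Real.pi_lt_d2
  constructor
  · apply Real.le_sqrt_of_sq_le; norm_num at *; linarith
  · rw [Real.sqrt_le_left (by norm_num)]; norm_num at *; linarith

/-- Hermite truncation error for the ReLU function `σ(t) = max(t,0)`: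
with `c_j = E[σ(t)h_j(t)]/j!` and `σ̃ = Σ_{j=0}^q c_j h_j`, one has
`E_{t∼N(0,1)}[(σ(t) - σ̃(t))²] ≤ 1/(√(2π)(q+1))`. -/
theorem relu_hermite_truncation_error (q : ℕ)
    (c : ℕ → ℝ)
    (hc : ∀ j, c j =
      (∫ t, max t 0 * hermiteR j t ∂(gaussianReal 0 1)) / (Nat.factorial j : ℝ)) :
    (∫ t, (max t 0 - ∑ j ∈ Finset.range (q + 1), c j * hermiteR j t) ^ 2
        ∂(gaussianReal 0 1)) ≤
      1 / (Real.sqrt (2 * π) * (q + 1)) := by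
  
  have hs : 0 < √(2*π) := by positivity
  have hsq : √(2*π)^2 = 2*π := Real.sq_sqrt (by positivity)
  have hp := Real.pi_pos
  obtain ⟨b1, b2⟩ := sqrt_bounds
  have hc' : ∀ j, ∫ x, max x 0 * (HP j).eval x * wG x = √(2*π) * j.factorial * c j := by
    intro j
    rw [hc j, gauss_int]
    simp_rw [hermiteR_eq]
    have : (j.factorial : ℝ) ≠ 0 := by positivity
    field_simp
  simp_rw [hermiteR_eq]
  rw [gauss_int, error_eq (q+1) c hc', inv_mul_cancel_left₀ hs.ne']
  have key : ∀ m q : ℕ, 2*m+2 ≤ q → q ≤ 2*m+3 →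
      1/2 - ∑ j ∈ Finset.range (q+1), c j^2 * j.factorial ≤ 1 / (√(2*π) * (q+1)) := by
    intro m q h1 h2
    have p := partial_sum c hc' m
    have s := series_bound m
    have mo : ∑ j ∈ Finset.range (2*m+3), c j^2 * (j.factorial : ℝ) ≤
        ∑ j ∈ Finset.range (q+1), c j^2 * j.factorial := by
      apply Finset.sum_le_sum_of_subset_of_nonneg
      · exact Finset.range_mono (by omega)
      · intros; positivity
    have e : 1/4 = (π/2)/(2*π) := by field_simp; norm_num
    have s2 := div_le_div_of_nonneg_right s (show 0 ≤ 2*π by positivity)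
    rw [sub_div] at s2
    have hq : (q:ℝ) + 1 ≤ 2*m+4 := by exact_mod_cast (by omega : q + 1 ≤ 2*m+4)
    have fin : 2 / (2*(m:ℝ)+4) / (2*π) ≤ 1 / (√(2*π) * (q+1)) := by
      rw [div_div, div_le_div_iff₀ (by positivity) (by positivity)]
      have : 2 * (√(2*π) * (q+1)) ≤ √(2*π) * (√(2*π) * (2*m+4)) := by gcongr; linarith
      have e5 : √(2*π) * (√(2*π) * (2*m+4)) = (2*m+4) * (2*π) := by rw [← hsq, Real.sqrt_sq hs.le]; ring
      linarith
    linarith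
  obtain ⟨h0, h1, -⟩ := coef_bound c hc'
  have hl : (0.159:ℝ) ≤ 1/(2*π) := by
    rw [le_div_iff₀ (by positivity)]
    have := Real.pi_lt_d4
    norm_num at *; linarith
  rcases lt_or_ge q 2 with h | h
  · have e : 1 / (√(2*π) * ((q:ℝ)+1)) = (1/√(2*π)) / (q+1) := by rw [div_div]
    have hb : (0.398:ℝ) ≤ 1/√(2*π) := by
      rw [le_div_iff₀ (by positivity)]
      norm_num at *; linarith
    rw [e]
    have hcc : (0.159:ℝ) ≤ c 0 ^ 2 := by
      rw [h0, inv_pow, hsq, ← one_div]; exact hl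
    generalize 1/√(2*π) = y at hb
    clear hl b1 b2 hs hsq key e hc hc' h0
    interval_cases q
    · simp only [zero_add, Finset.sum_range_one]
      norm_num at *; linarith
    · simp only [Finset.sum_range_succ, Finset.sum_range_zero, h1]
      norm_num at *; linarith
  · exact key ((q-2)/2) q (by omega) (by omega)
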